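/- arXiv:2006.14192 — 2 statements merged into one kernel-verified Lean document; each statement's English description precedes it below -/
import Mathlib

section
/- Let f : ℝ³ → ℝ be smooth with support contained in the spherical shell S_h(r_m, r_M). Then for every natural number l, every integer m with |m| ≤ l, and every scattering angle ω ∈ (π/2, π), the (l,m) spherical-harmonic coefficient of the data equals a weighted Abel-type integral of the (l,m) coefficient of f: ∫₀^{2π} ∫₀^π (R_T f)(α,β,ω) · conj(Y_l^m(β,α)) · sin β dβ dα = 2π ∫₀^{2ω−π} r^ω(γ) (sin γ / sin ω) · f_{lm}(r^ω(γ)) · P_l(cos γ) dγ. -/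
noncomputable section
open Real MeasureTheory

/-- Legendre polynomial of degree `l` (Rodrigues' formula). -/
def legP (l : ℕ) (x : ℝ) : ℝ :=
  (1 / (2 ^ l * Nat.factorial l : ℝ)) * iteratedDeriv l (fun y : ℝ => (y ^ 2 - 1) ^ l) x
/-- The point `Θ(γ,ψ)` on the unit sphere. -/
def Theta (γ ψ : ℝ) : Fin 3 → ℝ := ![Real.cos ψ * Real.sin γ, Real.sin ψ * Real.sin γ, Real.cos γ]

/-- Rotation by angle `α` about the `z`-axis. -/
def uRot (α : ℝ) : Matrix (Fin 3) (Fin 3) ℝ :=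
  ![![Real.cos α, -Real.sin α, 0], ![Real.sin α, Real.cos α, 0], ![0, 0, 1]]

/-- Rotation by angle `β` about the `y`-axis. -/
def aRot (β : ℝ) : Matrix (Fin 3) (Fin 3) ℝ :=
  ![![Real.cos β, 0, Real.sin β], ![0, 1, 0], ![-Real.sin β, 0, Real.cos β]]

/-- The radial part `r^ω(γ) = R sin(ω - γ)/sin ω`. -/
def rr (R ω γ : ℝ) : ℝ := R * Real.sin (ω - γ) / Real.sin ω

/-- The spherical shell `S_h(r_m, r_M)` (Euclidean norm). -/
def shell (rm rM : ℝ) : Set (Fin 3 → ℝ) :=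
  {x | rm ≤ Real.sqrt ((x 0) ^ 2 + (x 1) ^ 2 + (x 2) ^ 2) ∧
       Real.sqrt ((x 0) ^ 2 + (x 1) ^ 2 + (x 2) ^ 2) ≤ rM}

/-- The toric Radon transform `R_T f(α, β, ω)`. -/
def RT (R : ℝ) (f : (Fin 3 → ℝ) → ℝ) (α β ω : ℝ) : ℝ :=
  ∫ γ in (0:ℝ)..(2 * ω - π), ∫ ψ in (0:ℝ)..(2 * π),
    f (rr R ω γ • Matrix.mulVec (uRot α * aRot β) (Theta γ ψ)) *
      (rr R ω γ * (Real.sin γ / Real.sin ω))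

/-- Associated Legendre function `P_l^m` for integer order `m` with `|m| ≤ l`. -/
def assocP (l : ℕ) (m : ℤ) (x : ℝ) : ℝ :=
  if 0 ≤ m then
    (-1 : ℝ) ^ m.toNat * (1 - x ^ 2) ^ ((m.toNat : ℝ) / 2) * iteratedDeriv m.toNat (legP l) x
  else
    (-1 : ℝ) ^ m.natAbs *
      ((Nat.factorial (l - m.natAbs) : ℝ) / (Nat.factorial (l + m.natAbs) : ℝ)) *
      ((-1 : ℝ) ^ m.natAbs * (1 - x ^ 2) ^ ((m.natAbs : ℝ) / 2) *
        iteratedDeriv m.natAbs (legP l) x)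

/-- Spherical harmonic `Y_l^m(γ, ψ)` of degree `l` and order `m`. -/
def sphY (l : ℕ) (m : ℤ) (γ ψ : ℝ) : ℂ :=
  (-1 : ℂ) ^ m *
    (Real.sqrt (((2 * l + 1) * Nat.factorial ((l : ℤ) - m).toNat) /
        (4 * π * Nat.factorial ((l : ℤ) + m).toNat)) : ℝ) *
    (assocP l m (Real.cos γ) : ℝ) * Complex.exp (Complex.I * m * ψ)

/-- The `(l,m)` spherical-harmonic coefficient `f_{lm}(r)` of `f`. -/
def coefflm (f : (Fin 3 → ℝ) → ℝ) (l : ℕ) (m : ℤ) (r : ℝ) : ℂ :=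
  ∫ ψ in (0:ℝ)..(2 * π), ∫ γ in (0:ℝ)..π,
    (f (r • Theta γ ψ) : ℂ) * (starRingEnd ℂ) (sphY l m γ ψ) * (Real.sin γ : ℂ)

theorem swap2 (G : ℝ → ℝ → ℂ) (hG : Continuous (fun q : ℝ × ℝ => G q.1 q.2)) (a b c d : ℝ) :
    ∫ x in a..b, ∫ y in c..d, G x y = ∫ y in c..d, ∫ x in a..b, G x y := by
  apply intervalIntegral_intervalIntegral_swap
  have : IntegrableOn (Function.uncurry G) (Set.uIcc a b ×ˢ Set.uIcc c d) := by
    apply ContinuousOn.integrableOn_compact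
    · exact isCompact_uIcc.prod isCompact_uIcc
    · exact hG.continuousOn
  exact this.mono_set (Set.prod_mono Set.uIoc_subset_uIcc Set.uIoc_subset_uIcc)

theorem exp_int (n : ℤ) :
    ∫ θ in (0:ℝ)..(2*π), Complex.exp (Complex.I * n * θ) = if n = 0 then 2 * π else 0 := by
  split_ifs with h
  · simp [h]
  · rw [integral_exp_mul_complex (by simpa using h)]
    have : Complex.exp (Complex.I * n * ((2 * π : ℝ) : ℂ)) = 1 := by
      rw [Complex.exp_eq_one_iff]
      exact ⟨n, by push_cast; ring⟩
    rw [this]; simp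

theorem coeff_int (P : Polynomial ℂ) (n : ℕ) :
    ∫ θ in (0:ℝ)..(2*π), P.eval (Complex.exp (Complex.I * θ)) * Complex.exp (-(Complex.I * n * θ))
      = 2 * π * P.coeff n := by
  induction P using Polynomial.induction_on' with
  | add p q hp hq =>
    simp only [Polynomial.eval_add, add_mul, Polynomial.coeff_add, mul_add]
    rw [intervalIntegral.integral_add, hp, hq]
    all_goals
      apply Continuous.intervalIntegrable
      fun_prop
  | monomial k c =>
    have : ∀ θ : ℝ, (Polynomial.monomial k c).eval (Complex.exp (Complex.I * θ)) *
        Complex.exp (-(Complex.I * n * θ)) = c * Complex.exp (Complex.I * ((k - n : ℤ) : ℂ) * θ) := by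
      intro θ
      rw [Polynomial.eval_monomial, ← Complex.exp_nat_mul, mul_assoc, ← Complex.exp_add]
      congr 2; push_cast; ring
    simp only [this]
    rw [intervalIntegral.integral_const_mul, exp_int, Polynomial.coeff_monomial]
    by_cases h : k = n
    · subst h; simp; ring
    · have : (k : ℤ) - n ≠ 0 := by omega
      simp [h, this]

theorem calc_core (K Ka Kb Kp Kt : ℝ → ℝ → ℝ → ℝ → ℂ)
    (hK : Continuous (fun q : ℝ × ℝ × ℝ × ℝ => K q.1 q.2.1 q.2.2.1 q.2.2.2))
    (hKa : Continuous (fun q : ℝ × ℝ × ℝ × ℝ => Ka q.1 q.2.1 q.2.2.1 q.2.2.2))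
    (hKb : Continuous (fun q : ℝ × ℝ × ℝ × ℝ => Kb q.1 q.2.1 q.2.2.1 q.2.2.2))
    (hKp : Continuous (fun q : ℝ × ℝ × ℝ × ℝ => Kp q.1 q.2.1 q.2.2.1 q.2.2.2))
    (hKt : Continuous (fun q : ℝ × ℝ × ℝ × ℝ => Kt q.1 q.2.1 q.2.2.1 q.2.2.2))
    (da : ∀ a b p t, HasDerivAt (fun x => K x b p t) (Ka a b p t) a)
    (db : ∀ a b p t, HasDerivAt (fun x => K a x p t) (Kb a b p t) b)
    (dp : ∀ a b p t, HasDerivAt (fun x => K a b x t) (Kp a b p t) p)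
    (dt : ∀ a b p t, HasDerivAt (fun x => K a b p x) (Kt a b p t) t)
    (pde : ∀ a b p t, (Real.sin b : ℂ) * Kt a b p t = Real.sin b * Real.cos p * Kb a b p t
      + Real.sin p * Ka a b p t - Real.cos b * Real.sin p * Kp a b p t)
    (pera : ∀ b p t, K (2 * π) b p t = K 0 b p t)
    (t₀ : ℝ) :
    ∫ a in (0:ℝ)..(2*π), ∫ b in (0:ℝ)..π, ∫ p in (0:ℝ)..(2*π), K a b p t₀ * (Real.sin b : ℂ)
    = ∫ a in (0:ℝ)..(2*π), ∫ b in (0:ℝ)..π, ∫ p in (0:ℝ)..(2*π), K a b p 0 * (Real.sin b : ℂ) := by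
  have hs : ∀ x : ℝ, HasDerivAt (fun x : ℝ => (Real.sin x : ℂ)) (Real.cos x : ℂ) x :=
    fun x => (Real.hasDerivAt_sin x).ofReal_comp
  have cs : Continuous (fun x : ℝ => (Real.sin x : ℂ)) := by fun_prop
  have cc : Continuous (fun x : ℝ => (Real.cos x : ℂ)) := by fun_prop
  -- three divergence terms
  have Z : ∀ t, ∫ a in (0:ℝ)..(2*π), ∫ b in (0:ℝ)..π, ∫ p in (0:ℝ)..(2*π),
      Kt a b p t * (Real.sin b : ℂ) = 0 := by
    intro t
    have e : ∀ a b p, Kt a b p t * (Real.sin b : ℂ) =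
        ((Real.cos b * Real.cos p * K a b p t + Real.sin b * Real.cos p * Kb a b p t)
          + Real.sin p * Ka a b p t)
        - (Real.cos b * Real.cos p * K a b p t + Real.cos b * Real.sin p * Kp a b p t) := by
      intro a b p
      rw [mul_comm, pde]; ring
    simp only [e]
    have e1 : ∀ a p, ∫ b in (0:ℝ)..π, ((Real.cos b * Real.cos p * K a b p t
        + Real.sin b * Real.cos p * Kb a b p t : ℂ)) = 0 := by
      intro a p
      rw [intervalIntegral.integral_eq_sub_of_hasDerivAt
        (f := fun b => (Real.sin b : ℂ) * Real.cos p * K a b p t)]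
      · simp
      · intro b _
        exact ((hs b).mul_const _).mul (db a b p t)
      · apply Continuous.intervalIntegrable; fun_prop
    have e2 : ∀ b p, ∫ a in (0:ℝ)..(2*π), ((Real.sin p : ℂ) * Ka a b p t) = 0 := by
      intro b p
      rw [intervalIntegral.integral_eq_sub_of_hasDerivAt
        (f := fun a => (Real.sin p : ℂ) * K a b p t)]
      · simp [pera]
      · intro a _
        exact (da a b p t).const_mul _
      · apply Continuous.intervalIntegrable; fun_prop
    have e3 : ∀ a b, ∫ p in (0:ℝ)..(2*π), ((Real.cos b * Real.cos p * K a b p t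
        + Real.cos b * Real.sin p * Kp a b p t : ℂ)) = 0 := by
      intro a b
      rw [intervalIntegral.integral_eq_sub_of_hasDerivAt
        (f := fun p => (Real.cos b : ℂ) * Real.sin p * K a b p t)]
      · simp
      · intro p _
        exact ((hs p).const_mul _).mul (dp a b p t)
      · apply Continuous.intervalIntegrable; fun_prop
    have i1 : ∀ a b, ∫ p in (0:ℝ)..(2*π),
      (((Real.cos b * Real.cos p * K a b p t + Real.sin b * Real.cos p * Kb a b p t)
          + Real.sin p * Ka a b p t)
        - (Real.cos b * Real.cos p * K a b p t + Real.cos b * Real.sin p * Kp a b p t) : ℂ)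
        = (∫ p in (0:ℝ)..(2*π), (Real.cos b * Real.cos p * K a b p t
            + Real.sin b * Real.cos p * Kb a b p t : ℂ))
          + ∫ p in (0:ℝ)..(2*π), (Real.sin p * Ka a b p t : ℂ) := by
      intro a b
      rw [intervalIntegral.integral_sub, e3, sub_zero, intervalIntegral.integral_add]
      all_goals apply Continuous.intervalIntegrable; fun_prop
    simp only [i1]
    have i2 : ∀ a, ∫ b in (0:ℝ)..π, ((∫ p in (0:ℝ)..(2*π), (Real.cos b * Real.cos p * K a b p t
            + Real.sin b * Real.cos p * Kb a b p t : ℂ))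
          + ∫ p in (0:ℝ)..(2*π), (Real.sin p * Ka a b p t : ℂ))
        = ∫ b in (0:ℝ)..π, ∫ p in (0:ℝ)..(2*π), (Real.sin p * Ka a b p t : ℂ) := by
      intro a
      rw [intervalIntegral.integral_add]
      · rw [swap2]
        · simp only [e1]; simp
        · fun_prop
      all_goals
        apply Continuous.intervalIntegrable
        apply intervalIntegral.continuous_parametric_intervalIntegral_of_continuous'
        fun_prop
    simp only [i2]
    rw [swap2]
    · have : ∀ b, ∫ a in (0:ℝ)..(2*π), ∫ p in (0:ℝ)..(2*π), (Real.sin p * Ka a b p t : ℂ) = 0 := by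
        intro b
        rw [swap2]
        · simp only [e2]; simp
        · fun_prop
      simp only [this]; simp
    · apply intervalIntegral.continuous_parametric_intervalIntegral_of_continuous'
      fun_prop
  have f1 : ∀ a b p, K a b p t₀ * (Real.sin b : ℂ) = K a b p 0 * (Real.sin b : ℂ)
      + ∫ t in (0:ℝ)..t₀, Kt a b p t * (Real.sin b : ℂ) := by
    intro a b p
    rw [intervalIntegral.integral_eq_sub_of_hasDerivAt
        (f := fun t => K a b p t * (Real.sin b : ℂ))]
    · ring
    · intro t _
      exact (dt a b p t).mul_const _
    · apply Continuous.intervalIntegrable; fun_prop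
  have g1 : Continuous fun q : ℝ × ℝ × ℝ =>
      ∫ t in (0:ℝ)..t₀, Kt q.1 q.2.1 q.2.2 t * (Real.sin q.2.1 : ℂ) := by
    apply intervalIntegral.continuous_parametric_intervalIntegral_of_continuous'
    fun_prop
  have f2 : ∀ a b, ∫ p in (0:ℝ)..(2*π), K a b p t₀ * (Real.sin b : ℂ) =
      (∫ p in (0:ℝ)..(2*π), K a b p 0 * (Real.sin b : ℂ)) +
      ∫ t in (0:ℝ)..t₀, ∫ p in (0:ℝ)..(2*π), Kt a b p t * (Real.sin b : ℂ) := by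
    intro a b
    simp only [f1 a b]
    rw [intervalIntegral.integral_add, swap2 (fun p t => Kt a b p t * (Real.sin b : ℂ))]
    · fun_prop
    · apply Continuous.intervalIntegrable; fun_prop
    · apply Continuous.intervalIntegrable
      exact g1.comp (by fun_prop : Continuous fun p : ℝ => (a, b, p))
  have f3 : ∀ a, ∫ b in (0:ℝ)..π, ∫ p in (0:ℝ)..(2*π), K a b p t₀ * (Real.sin b : ℂ) =
      (∫ b in (0:ℝ)..π, ∫ p in (0:ℝ)..(2*π), K a b p 0 * (Real.sin b : ℂ)) +
      ∫ t in (0:ℝ)..t₀, ∫ b in (0:ℝ)..π, ∫ p in (0:ℝ)..(2*π), Kt a b p t * (Real.sin b : ℂ) := by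
    intro a
    simp only [f2 a]
    rw [intervalIntegral.integral_add,
      swap2 (fun b t => ∫ p in (0:ℝ)..(2*π), Kt a b p t * (Real.sin b : ℂ))]
    · apply intervalIntegral.continuous_parametric_intervalIntegral_of_continuous'
      fun_prop
    · apply Continuous.intervalIntegrable
      apply intervalIntegral.continuous_parametric_intervalIntegral_of_continuous'
      fun_prop
    · apply Continuous.intervalIntegrable
      apply intervalIntegral.continuous_parametric_intervalIntegral_of_continuous'
      apply intervalIntegral.continuous_parametric_intervalIntegral_of_continuous'
      fun_prop
  simp only [f3]
  rw [intervalIntegral.integral_add,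
    swap2 (fun a t => ∫ b in (0:ℝ)..π, ∫ p in (0:ℝ)..(2*π), Kt a b p t * (Real.sin b : ℂ))]
  · simp only [Z]; simp
  · apply intervalIntegral.continuous_parametric_intervalIntegral_of_continuous'
    apply intervalIntegral.continuous_parametric_intervalIntegral_of_continuous'
    fun_prop
  · apply Continuous.intervalIntegrable
    apply intervalIntegral.continuous_parametric_intervalIntegral_of_continuous'
    apply intervalIntegral.continuous_parametric_intervalIntegral_of_continuous'
    fun_prop
  · apply Continuous.intervalIntegrable
    apply intervalIntegral.continuous_parametric_intervalIntegral_of_continuous'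
    apply intervalIntegral.continuous_parametric_intervalIntegral_of_continuous'
    apply intervalIntegral.continuous_parametric_intervalIntegral_of_continuous'
    fun_prop

theorem coeff_quad (u c A B : ℂ) (h : 4 * A * B = u ^ 2 - c ^ 2) (l k : ℕ) :
    ((Polynomial.C A * Polynomial.X ^ 2 + Polynomial.C u * Polynomial.X + Polynomial.C B) ^ l).coeff (l + k)
      * 2 ^ l
    = (2 * A) ^ k * (((Polynomial.X + Polynomial.C u) ^ 2 - Polynomial.C (c ^ 2)) ^ l).coeff (l + k) := by
  by_cases hA : A = 0
  · subst hA
    have hc : c ^ 2 = u ^ 2 := by linear_combination h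
    have e : ((Polynomial.X + Polynomial.C u) ^ 2 - Polynomial.C (c ^ 2)) ^ l
        = (Polynomial.X + Polynomial.C (2 * u)) ^ l * Polynomial.X ^ l := by
      rw [← mul_pow, hc]; congr 1; simp only [map_pow, map_mul, Polynomial.C_ofNat]; ring
    rw [e, add_comm l k, Polynomial.coeff_mul_X_pow]
    have d : (Polynomial.C u * Polynomial.X + Polynomial.C B).natDegree ≤ 1 :=
      Polynomial.natDegree_linear_le
    rcases Nat.eq_zero_or_pos k with hk | hk
    · subst hk
      have := Polynomial.coeff_pow_of_natDegree_le (m := l) d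
      rw [mul_one] at this
      rw [map_zero, zero_mul, zero_add, zero_add, this, Polynomial.coeff_zero_eq_eval_zero]
      simp [mul_pow]
      ring
    · rw [Polynomial.coeff_eq_zero_of_natDegree_lt]
      · simp [hk.ne']
      · simp only [map_zero, zero_mul, zero_add]
        have := Polynomial.natDegree_pow_le_of_le l d
        omega
  · have e : Polynomial.C ((4 * A) ^ l) *
        (Polynomial.C A * Polynomial.X ^ 2 + Polynomial.C u * Polynomial.X + Polynomial.C B) ^ l
        = (((Polynomial.X + Polynomial.C u) ^ 2 - Polynomial.C (c ^ 2)) ^ l).comp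
            (Polynomial.C (2 * A) * Polynomial.X) := by
      have hc : c ^ 2 = u ^ 2 - 4 * A * B := by rw [h]; ring
      rw [map_pow, ← mul_pow, hc]
      simp only [Polynomial.pow_comp, Polynomial.sub_comp, Polynomial.add_comp, Polynomial.X_comp,
        Polynomial.C_comp]
      congr 1
      simp only [map_pow, map_mul, map_sub, Polynomial.C_ofNat]; ring
    have e' := congrArg (fun P => P.coeff (l + k)) e
    simp only [Polynomial.coeff_C_mul, Polynomial.comp_C_mul_X_coeff] at e'
    have h2 : (2 * A) ^ l ≠ 0 := pow_ne_zero _ (mul_ne_zero two_ne_zero hA)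
    apply mul_left_cancel₀ h2
    rw [pow_add] at e'
    rw [show (4 * A) ^ l = (2 * A) ^ l * 2 ^ l by rw [← mul_pow]; ring] at e'
    linear_combination e'

theorem fourier_quad (u c A B : ℂ) (h : 4 * A * B = u ^ 2 - c ^ 2) (l k : ℕ) :
    ∫ θ in (0:ℝ)..(2*π), (u + A * Complex.exp (Complex.I * θ) + B * Complex.exp (-(Complex.I * θ))) ^ l
      * Complex.exp (-(Complex.I * k * θ))
    = 2 * π / 2 ^ l * (2 * A) ^ k *
      (((Polynomial.X + Polynomial.C u) ^ 2 - Polynomial.C (c ^ 2)) ^ l).coeff (l + k) := by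
  have e := coeff_quad u c A B h l k
  have e2 := coeff_int ((Polynomial.C A * Polynomial.X ^ 2 + Polynomial.C u * Polynomial.X
    + Polynomial.C B) ^ l) (l + k)
  have e3 : ∀ θ : ℝ, (u + A * Complex.exp (Complex.I * θ) + B * Complex.exp (-(Complex.I * θ))) ^ l
      * Complex.exp (-(Complex.I * k * θ)) =
      Polynomial.eval (Complex.exp (Complex.I * θ)) ((Polynomial.C A * Polynomial.X ^ 2
      + Polynomial.C u * Polynomial.X + Polynomial.C B) ^ l)
      * Complex.exp (-(Complex.I * ((l + k : ℕ) : ℂ) * θ)) := by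
    intro θ
    have : Complex.exp (-(Complex.I * ((l + k : ℕ) : ℂ) * θ)) =
      Complex.exp (-(Complex.I * θ)) ^ l * Complex.exp (-(Complex.I * k * θ)) := by
      rw [← Complex.exp_nat_mul, ← Complex.exp_add]; congr 1; push_cast; ring
    rw [this, ← mul_assoc, Polynomial.eval_pow, ← mul_pow]
    congr 2
    simp only [Polynomial.eval_add, Polynomial.eval_mul, Polynomial.eval_C, Polynomial.eval_pow,
      Polynomial.eval_X]
    rw [Complex.exp_neg]
    field_simp [Complex.exp_ne_zero]
    ring
  simp only [e3]
  rw [e2]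
  field_simp
  linear_combination e

theorem iter_poly (P : Polynomial ℝ) (n : ℕ) :
    iteratedDeriv n (fun x => P.eval x) = fun x => ((Polynomial.derivative)^[n] P).eval x := by
  induction n with
  | zero => simp
  | succ n ih =>
    rw [iteratedDeriv_succ, ih, Function.iterate_succ_apply']
    funext x
    exact Polynomial.deriv _

theorem legP_poly (l : ℕ) : legP l = fun x => (Polynomial.C (1 / (2 ^ l * Nat.factorial l : ℝ)) *
    (Polynomial.derivative)^[l] ((Polynomial.X ^ 2 - 1) ^ l)).eval x := by
  funext x
  have : (fun y : ℝ => (y ^ 2 - 1) ^ l) =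
      fun y => Polynomial.eval y ((Polynomial.X ^ 2 - 1) ^ l : Polynomial ℝ) := by
    funext y; simp
  rw [legP, this, iter_poly]
  simp

theorem legP_iter (l k : ℕ) (x : ℝ) : iteratedDeriv k (legP l) x =
    (Nat.factorial (l + k) : ℝ) / (2 ^ l * Nat.factorial l) *
      (((Polynomial.X + Polynomial.C x) ^ 2 - 1) ^ l : Polynomial ℝ).coeff (l + k) := by
  rw [legP_poly, iter_poly]
  have e : (((Polynomial.X + Polynomial.C x) ^ 2 - 1) ^ l : Polynomial ℝ)
      = Polynomial.taylor x ((Polynomial.X ^ 2 - 1) ^ l) := by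
    simp [Polynomial.taylor_apply]
  rw [e, Polynomial.taylor_coeff, Polynomial.iterate_derivative_C_mul, ← Function.iterate_add_apply,
    add_comm k l, ← Polynomial.factorial_smul_hasseDeriv]
  simp
  ring

theorem legP_iter_contDiff (l k : ℕ) (n : WithTop ℕ∞) : ContDiff ℝ n (iteratedDeriv k (legP l)) := by
  rw [legP_poly, iter_poly]
  exact Polynomial.contDiff_aeval _ _

theorem legP_iter_complex (l k : ℕ) (x : ℝ) : ((iteratedDeriv k (legP l) x : ℝ) : ℂ) =
    (Nat.factorial (l + k) : ℂ) / (2 ^ l * Nat.factorial l) *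
      (((Polynomial.X + Polynomial.C (x : ℂ)) ^ 2 - 1) ^ l : Polynomial ℂ).coeff (l + k) := by
  have : (((Polynomial.X + Polynomial.C (x : ℂ)) ^ 2 - 1) ^ l : Polynomial ℂ) =
    Polynomial.map Complex.ofRealHom (((Polynomial.X + Polynomial.C x) ^ 2 - 1) ^ l) := by simp
  rw [this, Polynomial.coeff_map, legP_iter]
  push_cast
  rfl

theorem hom_coeff (l : ℕ) (x c : ℂ) :
    (((Polynomial.X + Polynomial.C (c * x)) ^ 2 - Polynomial.C (c ^ 2)) ^ l).coeff l
     = c ^ l * (((Polynomial.X + Polynomial.C x) ^ 2 - 1) ^ l).coeff l := by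
  by_cases hc : c = 0
  · subst hc
    rcases Nat.eq_zero_or_pos l with h | h
    · subst h; simp
    · have : l ≠ 2 * l := by omega
      simp [h.ne', ← pow_mul, Polynomial.coeff_X_pow, this]
  · have e : (((Polynomial.X + Polynomial.C (c * x)) ^ 2 - Polynomial.C (c ^ 2)) ^ l).comp
        (Polynomial.C c * Polynomial.X) =
        Polynomial.C ((c ^ 2) ^ l) * ((Polynomial.X + Polynomial.C x) ^ 2 - 1) ^ l := by
      rw [map_pow Polynomial.C (c ^ 2) l, ← mul_pow]
      simp only [Polynomial.pow_comp, Polynomial.sub_comp, Polynomial.add_comp, Polynomial.X_comp,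
        Polynomial.C_comp]
      congr 1
      simp only [map_pow, map_mul]; ring
    have e' := congrArg (fun P => P.coeff l) e
    simp only [Polynomial.coeff_C_mul, Polynomial.comp_C_mul_X_coeff] at e'
    have h2 : c ^ l ≠ 0 := pow_ne_zero _ hc
    apply mul_left_cancel₀ h2
    rw [← pow_mul c, mul_comm 2 l, pow_mul c, pow_two (c ^ l)] at e'
    linear_combination e'

/-- Laplace integral. -/
theorem laplace (c A B : ℂ) (x : ℝ) (h : 4 * A * B = (c * x) ^ 2 - c ^ 2) (l : ℕ) :
    ∫ θ in (0:ℝ)..(2*π), (c * x + A * Complex.exp (Complex.I * θ)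
      + B * Complex.exp (-(Complex.I * θ))) ^ l = 2 * π * legP l x * c ^ l := by
  have e := fourier_quad (c * x) c A B h l 0
  simp only [Nat.cast_zero, mul_zero, zero_mul, neg_zero, Complex.exp_zero, mul_one, pow_zero,
    add_zero] at e
  rw [e, hom_coeff]
  have := legP_iter_complex l 0 x
  rw [iteratedDeriv_zero, add_zero] at this
  rw [this]
  have : (Nat.factorial l : ℂ) ≠ 0 := by exact_mod_cast Nat.factorial_ne_zero l
  field_simp

def VV (a b p s : ℝ) : Fin 3 → ℝ :=
  ![cos a * (cos b * cos p * sin s + sin b * cos s) - sin a * (sin p * sin s),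
    sin a * (cos b * cos p * sin s + sin b * cos s) + cos a * (sin p * sin s),
    -(sin b * cos p * sin s) + cos b * cos s]

theorem VV_eq (a b p s : ℝ) : Matrix.mulVec (uRot a * aRot b) (Theta s p) = VV a b p s := by
  rw [← Matrix.mulVec_mulVec]
  funext i
  fin_cases i <;>
    simp [uRot, aRot, Theta, VV, Matrix.mulVec, dotProduct, Fin.sum_univ_three] <;> ring_nf <;> simp

theorem VV_zero (a b p : ℝ) : VV a b p 0 = Theta b a := by
  funext i
  fin_cases i <;> simp [Theta, VV]

def VVa (a b p s : ℝ) : Fin 3 → ℝ :=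
  ![-sin a * (cos b * cos p * sin s + sin b * cos s) - cos a * (sin p * sin s),
    cos a * (cos b * cos p * sin s + sin b * cos s) + -sin a * (sin p * sin s),
    0]
def VVb (a b p s : ℝ) : Fin 3 → ℝ :=
  ![cos a * (-sin b * cos p * sin s + cos b * cos s),
    sin a * (-sin b * cos p * sin s + cos b * cos s),
    -(cos b * cos p * sin s) + -sin b * cos s]
def VVp (a b p s : ℝ) : Fin 3 → ℝ :=
  ![cos a * (cos b * -sin p * sin s) - sin a * (cos p * sin s),
    sin a * (cos b * -sin p * sin s) + cos a * (cos p * sin s),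
    -(sin b * -sin p * sin s)]
def VVs (a b p s : ℝ) : Fin 3 → ℝ :=
  ![cos a * (cos b * cos p * cos s + sin b * -sin s) - sin a * (sin p * cos s),
    sin a * (cos b * cos p * cos s + sin b * -sin s) + cos a * (sin p * cos s),
    -(sin b * cos p * cos s) + cos b * -sin s]

theorem VV_da (a b p s : ℝ) : HasDerivAt (fun x => VV x b p s) (VVa a b p s) a := by
  rw [hasDerivAt_pi]
  intro i
  fin_cases i
  · exact ((hasDerivAt_cos a).mul_const _).sub ((hasDerivAt_sin a).mul_const _)
  · exact ((hasDerivAt_sin a).mul_const _).add ((hasDerivAt_cos a).mul_const _)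
  · exact hasDerivAt_const _ _

theorem VV_db (a b p s : ℝ) : HasDerivAt (fun x => VV a x p s) (VVb a b p s) b := by
  rw [hasDerivAt_pi]
  intro i
  have h := (((hasDerivAt_cos b).mul_const (cos p)).mul_const (sin s)).add
    ((hasDerivAt_sin b).mul_const (cos s))
  fin_cases i
  · exact (h.const_mul (cos a)).sub_const _
  · exact (h.const_mul (sin a)).add_const _
  · exact ((((hasDerivAt_sin b).mul_const (cos p)).mul_const (sin s)).neg).add
      ((hasDerivAt_cos b).mul_const (cos s))

theorem VV_dp (a b p s : ℝ) : HasDerivAt (fun x => VV a b x s) (VVp a b p s) p := by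
  rw [hasDerivAt_pi]
  intro i
  have h := (((hasDerivAt_cos p).const_mul (cos b)).mul_const (sin s)).add_const (sin b * cos s)
  have h' := (hasDerivAt_sin p).mul_const (sin s)
  fin_cases i
  · exact (h.const_mul (cos a)).sub (h'.const_mul _)
  · exact (h.const_mul (sin a)).add (h'.const_mul _)
  · exact ((((hasDerivAt_cos p).const_mul (sin b)).mul_const (sin s)).neg).add_const _

theorem VV_ds (a b p s : ℝ) : HasDerivAt (fun x => VV a b p x) (VVs a b p s) s := by
  rw [hasDerivAt_pi]
  intro i
  have h := ((hasDerivAt_sin s).const_mul (cos b * cos p)).add ((hasDerivAt_cos s).const_mul (sin b))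
  have h' := (hasDerivAt_sin s).const_mul (sin p)
  fin_cases i
  · exact (h.const_mul (cos a)).sub (h'.const_mul _)
  · exact (h.const_mul (sin a)).add (h'.const_mul _)
  · exact (((hasDerivAt_sin s).const_mul (sin b * cos p)).neg).add ((hasDerivAt_cos s).const_mul (cos b))

theorem VV_pde (a b p s : ℝ) : sin b • VVs a b p s =
    (sin b * cos p) • VVb a b p s + sin p • VVa a b p s - (cos b * sin p) • VVp a b p s := by
  have h1 := sin_sq_add_cos_sq b
  have h2 := sin_sq_add_cos_sq p
  funext i
  fin_cases i <;> simp [VVs, VVb, VVa, VVp]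
  · linear_combination cos a * sin s * (sin b ^ 2 * h2 - sin p ^ 2 * h1)
  · linear_combination sin a * sin s * (sin b ^ 2 * h2 - sin p ^ 2 * h1)
  · linear_combination sin b * cos b * sin s * h2

theorem VV_cont' {X : Type*} [TopologicalSpace X] {g1 g2 g3 g4 : X → ℝ} (h1 : Continuous g1)
    (h2 : Continuous g2) (h3 : Continuous g3) (h4 : Continuous g4) :
    Continuous (fun q => VV (g1 q) (g2 q) (g3 q) (g4 q)) := by
  apply continuous_pi; intro i; fin_cases i <;> simp [VV] <;> fun_prop
theorem VV_cont : Continuous (fun q : ℝ × ℝ × ℝ × ℝ => VV q.1 q.2.1 q.2.2.1 q.2.2.2) := by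
  apply continuous_pi; intro i; fin_cases i <;> simp [VV] <;> fun_prop
theorem VVa_cont : Continuous (fun q : ℝ × ℝ × ℝ × ℝ => VVa q.1 q.2.1 q.2.2.1 q.2.2.2) := by
  apply continuous_pi; intro i; fin_cases i <;> simp [VVa] <;> fun_prop
theorem VVb_cont : Continuous (fun q : ℝ × ℝ × ℝ × ℝ => VVb q.1 q.2.1 q.2.2.1 q.2.2.2) := by
  apply continuous_pi; intro i; fin_cases i <;> simp [VVb] <;> fun_prop
theorem VVp_cont : Continuous (fun q : ℝ × ℝ × ℝ × ℝ => VVp q.1 q.2.1 q.2.2.1 q.2.2.2) := by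
  apply continuous_pi; intro i; fin_cases i <;> simp [VVp] <;> fun_prop
theorem VVs_cont : Continuous (fun q : ℝ × ℝ × ℝ × ℝ => VVs q.1 q.2.1 q.2.2.1 q.2.2.2) := by
  apply continuous_pi; intro i; fin_cases i <;> simp [VVs] <;> fun_prop

theorem transport (F S : (Fin 3 → ℝ) → ℂ) (hF : ContDiff ℝ 1 F) (hS : ContDiff ℝ 1 S) (γ t₀ : ℝ) :
    ∫ a in (0:ℝ)..(2*π), ∫ b in (0:ℝ)..π, ∫ p in (0:ℝ)..(2*π),
      F (VV a b p (t₀ + γ)) * S (VV a b p t₀) * (Real.sin b : ℂ)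
    = ∫ a in (0:ℝ)..(2*π), ∫ b in (0:ℝ)..π, ∫ p in (0:ℝ)..(2*π),
      F (VV a b p (0 + γ)) * S (VV a b p 0) * (Real.sin b : ℂ) := by
  have cF := hF.continuous
  have cS := hS.continuous
  have cF' := hF.continuous_fderiv (by norm_num)
  have cS' := hS.continuous_fderiv (by norm_num)
  have dF : ∀ v, HasFDerivAt F (fderiv ℝ F v) v :=
    fun v => (hF.differentiable (by norm_num) v).hasFDerivAt
  have dS : ∀ v, HasFDerivAt S (fderiv ℝ S v) v :=
    fun v => (hS.differentiable (by norm_num) v).hasFDerivAt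
  have s1 : Continuous (fun q : ℝ × ℝ × ℝ × ℝ => VV q.1 q.2.1 q.2.2.1 (q.2.2.2 + γ)) :=
    VV_cont.comp (by fun_prop : Continuous fun q : ℝ × ℝ × ℝ × ℝ => (q.1, q.2.1, q.2.2.1, q.2.2.2 + γ))
  have shift : ∀ U : ℝ → ℝ → ℝ → ℝ → Fin 3 → ℝ,
      Continuous (fun q : ℝ × ℝ × ℝ × ℝ => U q.1 q.2.1 q.2.2.1 q.2.2.2) →
      Continuous (fun q : ℝ × ℝ × ℝ × ℝ =>
        fderiv ℝ F (VV q.1 q.2.1 q.2.2.1 (q.2.2.2 + γ)) (U q.1 q.2.1 q.2.2.1 (q.2.2.2 + γ))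
          * S (VV q.1 q.2.1 q.2.2.1 q.2.2.2)
        + F (VV q.1 q.2.1 q.2.2.1 (q.2.2.2 + γ)) *
          fderiv ℝ S (VV q.1 q.2.1 q.2.2.1 q.2.2.2) (U q.1 q.2.1 q.2.2.1 q.2.2.2)) := by
    intro U hU
    have u1 : Continuous (fun q : ℝ × ℝ × ℝ × ℝ => U q.1 q.2.1 q.2.2.1 (q.2.2.2 + γ)) :=
      hU.comp (by fun_prop : Continuous fun q : ℝ × ℝ × ℝ × ℝ => (q.1, q.2.1, q.2.2.1, q.2.2.2 + γ))
    have a1 := (cF'.comp s1).clm_apply u1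
    have a2 := (cS'.comp VV_cont).clm_apply hU
    have a3 := cS.comp VV_cont
    have a4 := cF.comp s1
    exact (a1.mul a3).add (a4.mul a2)
  refine calc_core (fun a b p t => F (VV a b p (t + γ)) * S (VV a b p t))
    (fun a b p t => fderiv ℝ F (VV a b p (t + γ)) (VVa a b p (t + γ)) * S (VV a b p t)
      + F (VV a b p (t + γ)) * fderiv ℝ S (VV a b p t) (VVa a b p t))
    (fun a b p t => fderiv ℝ F (VV a b p (t + γ)) (VVb a b p (t + γ)) * S (VV a b p t)
      + F (VV a b p (t + γ)) * fderiv ℝ S (VV a b p t) (VVb a b p t))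
    (fun a b p t => fderiv ℝ F (VV a b p (t + γ)) (VVp a b p (t + γ)) * S (VV a b p t)
      + F (VV a b p (t + γ)) * fderiv ℝ S (VV a b p t) (VVp a b p t))
    (fun a b p t => fderiv ℝ F (VV a b p (t + γ)) (VVs a b p (t + γ)) * S (VV a b p t)
      + F (VV a b p (t + γ)) * fderiv ℝ S (VV a b p t) (VVs a b p t))
    ?_ (shift _ VVa_cont) (shift _ VVb_cont) (shift _ VVp_cont) (shift _ VVs_cont) ?_ ?_ ?_ ?_ ?_ ?_ t₀
  · exact (cF.comp s1).mul (cS.comp VV_cont)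
  · intro a b p t
    exact ((dF _).comp_hasDerivAt a (VV_da a b p (t + γ))).mul
      ((dS _).comp_hasDerivAt a (VV_da a b p t))
  · intro a b p t
    exact ((dF _).comp_hasDerivAt b (VV_db a b p (t + γ))).mul
      ((dS _).comp_hasDerivAt b (VV_db a b p t))
  · intro a b p t
    exact ((dF _).comp_hasDerivAt p (VV_dp a b p (t + γ))).mul
      ((dS _).comp_hasDerivAt p (VV_dp a b p t))
  · intro a b p t
    exact (((dF _).comp_hasDerivAt (t + γ) (VV_ds a b p (t + γ))).comp_add_const t γ).mul
      ((dS _).comp_hasDerivAt t (VV_ds a b p t))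
  · intro a b p t
    have h1 := congrArg (fderiv ℝ F (VV a b p (t + γ))) (VV_pde a b p (t + γ))
    have h2 := congrArg (fderiv ℝ S (VV a b p t)) (VV_pde a b p t)
    simp only [map_add, map_sub, map_smul, Complex.real_smul, Complex.ofReal_mul] at h1 h2
    linear_combination S (VV a b p t) * h1 + F (VV a b p (t + γ)) * h2
  · intro b p t
    have : ∀ s, VV (2 * π) b p s = VV 0 b p s := by intro s; simp [VV]
    simp only [this]

def WW (l k : ℕ) (v : Fin 3 → ℝ) : ℂ :=
  ((v 0 : ℂ) - Complex.I * v 1) ^ k * ((iteratedDeriv k (legP l) (v 2) : ℝ) : ℂ)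

theorem WW_contDiff (l k : ℕ) : ContDiff ℝ 1 (WW l k) := by
  have h := legP_iter_contDiff l k 1
  have h0 : ∀ i : Fin 3, ContDiff ℝ 1 (fun v : Fin 3 → ℝ => v i) := fun i => contDiff_apply _ _ i
  have c : ContDiff ℝ 1 (fun x : ℝ => (x : ℂ)) := Complex.ofRealCLM.contDiff
  unfold WW
  exact (((c.comp (h0 0)).sub (contDiff_const.mul (c.comp (h0 1)))).pow k).mul
    (c.comp (h.comp (h0 2)))

def LL (θ : ℝ) (v : Fin 3 → ℝ) : ℂ :=
  v 2 + Complex.I * (v 0 * Real.cos θ + v 1 * Real.sin θ)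

theorem exp_I_real (θ : ℝ) : Complex.exp (Complex.I * θ) = Real.cos θ + Complex.I * Real.sin θ := by
  rw [mul_comm, Complex.exp_mul_I]; push_cast; ring
theorem exp_neg_I_real (θ : ℝ) :
    Complex.exp (-(Complex.I * θ)) = Real.cos θ - Complex.I * Real.sin θ := by
  have := exp_I_real (-θ)
  simp only [Real.cos_neg, Real.sin_neg, Complex.ofReal_neg, mul_neg] at this
  rw [this]; ring

theorem WW_int (l k : ℕ) (v : Fin 3 → ℝ) (hv : v 0 ^ 2 + v 1 ^ 2 + v 2 ^ 2 = 1) :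
    ∫ θ in (0:ℝ)..(2*π), LL θ v ^ l * Complex.exp (-(Complex.I * k * θ))
    = (2 * π * Complex.I ^ k * (Nat.factorial l / Nat.factorial (l + k))) * WW l k v := by
  have hv' : (v 0 : ℂ) ^ 2 + (v 1 : ℂ) ^ 2 + (v 2 : ℂ) ^ 2 = 1 := by exact_mod_cast hv
  have e := fourier_quad (v 2) 1 (Complex.I * (v 0 - Complex.I * v 1) / 2)
    (Complex.I * (v 0 + Complex.I * v 1) / 2)
    (by
      have := Complex.I_sq
      linear_combination (-1 : ℂ) * hv' + ((v 0 : ℂ) ^ 2 - (v 1 : ℂ) ^ 2 * (Complex.I ^ 2 - 1)) * this) l k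
  have e2 : ∀ θ : ℝ, LL θ v = v 2 + Complex.I * (v 0 - Complex.I * v 1) / 2 * Complex.exp (Complex.I * θ)
      + Complex.I * (v 0 + Complex.I * v 1) / 2 * Complex.exp (-(Complex.I * θ)) := by
    intro θ
    rw [exp_I_real, exp_neg_I_real, LL]
    linear_combination (Complex.I * v 1 * Real.sin θ) * Complex.I_sq
  simp only [e2]
  rw [e, WW, legP_iter_complex]
  have h1 : (Nat.factorial l : ℂ) ≠ 0 := by exact_mod_cast Nat.factorial_ne_zero l
  have h2 : (Nat.factorial (l + k) : ℂ) ≠ 0 := by exact_mod_cast Nat.factorial_ne_zero (l + k)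
  rw [show 2 * (Complex.I * (v 0 - Complex.I * v 1) / 2) = Complex.I * (v 0 - Complex.I * v 1) by ring,
    mul_pow]
  simp only [one_pow, map_one]
  field_simp

theorem VV_unit (a b p s : ℝ) : VV a b p s 0 ^ 2 + VV a b p s 1 ^ 2 + VV a b p s 2 ^ 2 = 1 := by
  have h1 := sin_sq_add_cos_sq a
  have h2 := sin_sq_add_cos_sq b
  have h3 := sin_sq_add_cos_sq p
  have h4 := sin_sq_add_cos_sq s
  simp [VV]
  linear_combination ((cos b * cos p * sin s + sin b * cos s) ^ 2 + (sin p * sin s) ^ 2) * h1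
    + ((cos p * sin s) ^ 2 + cos s ^ 2) * h2 + sin s ^ 2 * h3 + h4

theorem LL_mean (l : ℕ) (θ a b γ : ℝ) :
    ∫ p in (0:ℝ)..(2*π), LL θ (VV a b p γ) ^ l
      = 2 * π * legP l (cos γ) * LL θ (Theta b a) ^ l := by
  set c : ℂ := LL θ (Theta b a) with hc
  set D : ℂ := cos θ * cos a + sin θ * sin a with hD
  set E : ℂ := sin θ * cos a - cos θ * sin a with hE
  set La : ℂ := Complex.I * D * cos b - sin b with hLa
  set Lb : ℂ := Complex.I * E with hLb
  have ha : (sin a : ℂ) ^ 2 + (cos a : ℂ) ^ 2 = 1 := by exact_mod_cast sin_sq_add_cos_sq a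
  have hb : (sin b : ℂ) ^ 2 + (cos b : ℂ) ^ 2 = 1 := by exact_mod_cast sin_sq_add_cos_sq b
  have hθ : (sin θ : ℂ) ^ 2 + (cos θ : ℂ) ^ 2 = 1 := by exact_mod_cast sin_sq_add_cos_sq θ
  have hγ : (sin γ : ℂ) ^ 2 + (cos γ : ℂ) ^ 2 = 1 := by exact_mod_cast sin_sq_add_cos_sq γ
  have hDE : D ^ 2 + E ^ 2 = 1 := by
    rw [hD, hE]
    linear_combination ((sin a : ℂ) ^ 2 + (cos a : ℂ) ^ 2) * hθ + ha
  have hc' : c = Complex.I * D * sin b + cos b := by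
    rw [hc, LL, hD]; simp [Theta]; ring
  have h0 : La ^ 2 + Lb ^ 2 + c ^ 2 = 0 := by
    rw [hLa, hLb, hc']
    linear_combination (Complex.I ^ 2 * D ^ 2 + 1) * hb + Complex.I ^ 2 * hDE + Complex.I_sq
  have := laplace c (sin γ * (La - Complex.I * Lb) / 2) (sin γ * (La + Complex.I * Lb) / 2) (cos γ)
    (by
      linear_combination (sin γ : ℂ) ^ 2 * h0 - c ^ 2 * hγ - (sin γ : ℂ) ^ 2 * Lb ^ 2 * Complex.I_sq) l
  rw [← this]
  congr 1
  funext p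
  congr 1
  rw [exp_I_real, exp_neg_I_real, hLa, hLb, hc', LL, hD, hE]
  simp only [VV, Matrix.cons_val]
  push_cast
  linear_combination Complex.I * Complex.sin γ * Complex.sin p *
    (Complex.sin θ * Complex.cos a - Complex.cos θ * Complex.sin a) * Complex.I_sq

theorem LL_cont {X : Type*} [TopologicalSpace X] {g : X → ℝ} {h : X → Fin 3 → ℝ}
    (hg : Continuous g) (hh : Continuous h) : Continuous (fun x => LL (g x) (h x)) := by
  unfold LL
  fun_prop

theorem WW_mean (l k : ℕ) (a b γ : ℝ) :
    ∫ p in (0:ℝ)..(2*π), WW l k (VV a b p γ) = 2 * π * legP l (cos γ) * WW l k (Theta b a) := by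
  have h1 : (Nat.factorial l : ℂ) ≠ 0 := by exact_mod_cast Nat.factorial_ne_zero l
  have h2 : (Nat.factorial (l + k) : ℂ) ≠ 0 := by exact_mod_cast Nat.factorial_ne_zero (l + k)
  have hpi : (π : ℂ) ≠ 0 := by exact_mod_cast pi_ne_zero
  have hC : (2 * π * Complex.I ^ k * (Nat.factorial l / Nat.factorial (l + k)) : ℂ) ≠ 0 := by
    simp [h1, h2, hpi]
  apply mul_left_cancel₀ hC
  rw [← intervalIntegral.integral_const_mul]
  simp only [← WW_int l k _ (VV_unit _ _ _ _)]
  rw [swap2 (fun p θ => LL θ (VV a b p γ) ^ l * Complex.exp (-(Complex.I * k * θ)))]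
  · simp only [intervalIntegral.integral_mul_const, LL_mean]
    have := WW_int l k _ (VV_unit a b 0 0)
    rw [VV_zero] at this
    rw [mul_left_comm, ← this, ← intervalIntegral.integral_const_mul]
    congr 1; funext θ; ring
  · have : Continuous (fun q : ℝ × ℝ => VV a b q.1 γ) :=
      VV_cont' continuous_const continuous_const continuous_fst continuous_const
    have h3 : Continuous (fun q : ℝ × ℝ => Complex.exp (-(Complex.I * k * (q.2 : ℂ)))) := by
      fun_prop
    have h4 := LL_cont (g := fun q : ℝ × ℝ => q.2) continuous_snd this
    exact (h4.pow l).mul h3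

theorem Theta_cont {X : Type*} [TopologicalSpace X] {g1 g2 : X → ℝ} (h1 : Continuous g1)
    (h2 : Continuous g2) : Continuous (fun q => Theta (g1 q) (g2 q)) := by
  apply continuous_pi; intro i; fin_cases i <;> simp [Theta] <;> fun_prop

theorem core (R ω : ℝ) (f : (Fin 3 → ℝ) → ℝ) (hf : ContDiff ℝ 1 f) (S : (Fin 3 → ℝ) → ℂ)
    (hS : ContDiff ℝ 1 S) (l : ℕ)
    (hm : ∀ a b γ, ∫ p in (0:ℝ)..(2*π), S (VV a b p γ) = 2 * π * legP l (cos γ) * S (Theta b a)) :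
    (∫ α in (0:ℝ)..(2 * π), ∫ β in (0:ℝ)..π,
        (RT R f α β ω : ℂ) * S (Theta β α) * (Real.sin β : ℂ))
      = ((2 * π : ℝ) : ℂ) * ∫ γ in (0:ℝ)..(2 * ω - π),
          ((rr R ω γ * (Real.sin γ / Real.sin ω) : ℝ) : ℂ) *
            (∫ ψ in (0:ℝ)..(2 * π), ∫ β in (0:ℝ)..π,
              (f (rr R ω γ • Theta β ψ) : ℂ) * S (Theta β ψ) * (Real.sin β : ℂ)) *
            ((legP l (Real.cos γ) : ℝ) : ℂ) := by
  have cf := hf.continuous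
  have cS := hS.continuous
  have cr : Continuous (fun γ => rr R ω γ) := by unfold rr; fun_prop
  set w : ℝ → ℝ := fun γ => rr R ω γ * (Real.sin γ / Real.sin ω) with hw
  have cw : Continuous w := by rw [hw]; fun_prop
  let G : ℝ → ℝ → ℝ → ℝ → ℂ := fun α β γ ψ =>
    (w γ : ℂ) * ((f (rr R ω γ • VV α β ψ γ) : ℂ) * S (Theta β α) * (Real.sin β : ℂ))
  have cG : ∀ {X : Type} [TopologicalSpace X] {g1 g2 g3 g4 : X → ℝ}, Continuous g1 → Continuous g2 →
      Continuous g3 → Continuous g4 → Continuous (fun q => G (g1 q) (g2 q) (g3 q) (g4 q)) := by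
    intro X _ g1 g2 g3 g4 h1 h2 h3 h4
    have v := VV_cont' h1 h2 h4 h3
    have t := Theta_cont h2 h1
    have a1 : Continuous (fun q => f (rr R ω (g3 q) • VV (g1 q) (g2 q) (g4 q) (g3 q))) :=
      cf.comp ((cr.comp h3).smul v)
    have a2 : Continuous (fun q => S (Theta (g2 q) (g1 q))) := cS.comp t
    simp only [G]
    fun_prop
  have e1 : ∀ α β, (RT R f α β ω : ℂ) * S (Theta β α) * (Real.sin β : ℂ)
      = ∫ γ in (0:ℝ)..(2 * ω - π), ∫ ψ in (0:ℝ)..(2 * π), G α β γ ψ := by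
    intro α β
    rw [RT, mul_assoc, ← intervalIntegral.integral_ofReal, ← intervalIntegral.integral_mul_const]
    congr 1; funext γ
    rw [← intervalIntegral.integral_ofReal, ← intervalIntegral.integral_mul_const]
    congr 1; funext ψ
    simp only [G, hw]
    rw [VV_eq]
    push_cast
    ring
  simp only [e1]
  have e2 : ∀ α, ∫ β in (0:ℝ)..π, ∫ γ in (0:ℝ)..(2 * ω - π), ∫ ψ in (0:ℝ)..(2 * π), G α β γ ψ
      = ∫ γ in (0:ℝ)..(2 * ω - π), ∫ β in (0:ℝ)..π, ∫ ψ in (0:ℝ)..(2 * π), G α β γ ψ := by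
    intro α
    apply swap2 (fun β γ => ∫ ψ in (0:ℝ)..(2 * π), G α β γ ψ)
    apply intervalIntegral.continuous_parametric_intervalIntegral_of_continuous'
    apply cG <;> fun_prop
  simp only [e2]
  rw [swap2 (fun α γ => ∫ β in (0:ℝ)..π, ∫ ψ in (0:ℝ)..(2 * π), G α β γ ψ)]
  swap
  · apply intervalIntegral.continuous_parametric_intervalIntegral_of_continuous'
    apply intervalIntegral.continuous_parametric_intervalIntegral_of_continuous'
    apply cG <;> fun_prop
  rw [← intervalIntegral.integral_const_mul]
  congr 1; funext γ
  simp only [G, intervalIntegral.integral_const_mul]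
  have hF : ContDiff ℝ 1 (fun v : Fin 3 → ℝ => (f (rr R ω γ • v) : ℂ)) :=
    Complex.ofRealCLM.contDiff.comp (hf.comp (contDiff_const_smul _))
  have T := transport _ S hF hS γ (-γ)
  simp only [zero_add, neg_add_cancel, VV_zero] at T
  rw [← T]
  simp only [intervalIntegral.integral_mul_const, intervalIntegral.integral_const_mul, hm, cos_neg]
  have e3 : ∀ a b : ℝ, (f (rr R ω γ • Theta b a) : ℂ) * (2 * π * legP l (cos γ) * S (Theta b a))
      * (Real.sin b : ℂ) = (2 * π * legP l (cos γ)) *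
      ((f (rr R ω γ • Theta b a) : ℂ) * S (Theta b a) * (Real.sin b : ℂ)) := by
    intro a b; ring
  simp only [e3, intervalIntegral.integral_const_mul, hw]
  push_cast
  ring

theorem sphY_pos (l k : ℕ) (β α : ℝ) (hβ : β ∈ Set.Icc 0 π) :
    ((((1 - cos β ^ 2) ^ ((k : ℝ) / 2) * iteratedDeriv k (legP l) (cos β) : ℝ)) : ℂ) *
      Complex.exp (-(Complex.I * k * α)) = WW l k (Theta β α) := by
  have hs : 0 ≤ sin β := sin_nonneg_of_mem_Icc hβ
  have e1 : (1 - cos β ^ 2) ^ ((k : ℝ) / 2) = sin β ^ k := by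
    rw [← sin_sq, ← rpow_natCast (sin β) 2, ← rpow_mul hs, ← rpow_natCast (sin β) k]
    congr 1; push_cast; ring
  have e2 : Complex.exp (-(Complex.I * k * α)) = Complex.exp (-(Complex.I * α)) ^ k := by
    rw [← Complex.exp_nat_mul]; congr 1; ring
  rw [e1, e2, exp_neg_I_real, WW]
  simp only [Theta, Matrix.cons_val]
  rw [Complex.ofReal_mul, Complex.ofReal_pow, mul_right_comm, ← mul_pow]
  congr 2
  push_cast; ring

theorem sphY_conj (l : ℕ) (m : ℤ) : ∃ (C : ℂ) (S : (Fin 3 → ℝ) → ℂ), ContDiff ℝ 1 S ∧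
    (∀ a b γ, ∫ p in (0:ℝ)..(2*π), S (VV a b p γ) = 2 * π * legP l (cos γ) * S (Theta b a)) ∧
    ∀ β ∈ Set.Icc 0 π, ∀ α : ℝ, (starRingEnd ℂ) (sphY l m β α) = C * S (Theta β α) := by
  rcases le_or_gt 0 m with h | h
  · obtain ⟨k, rfl⟩ := Int.eq_ofNat_of_zero_le h
    refine ⟨((-1 : ℂ) ^ (k : ℤ) *
      (Real.sqrt (((2 * l + 1) * Nat.factorial ((l : ℤ) - k).toNat) /
        (4 * π * Nat.factorial ((l : ℤ) + k).toNat)) : ℝ)) * (-1) ^ k, WW l k, WW_contDiff l k,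
        WW_mean l k, ?_⟩
    intro β hβ α
    rw [← sphY_pos l k β α hβ]
    simp only [sphY, assocP, h, if_true, Int.toNat_natCast, map_mul, map_pow, Complex.conj_ofReal,
      ← Complex.exp_conj, Complex.conj_I, Complex.ofReal_mul, Complex.ofReal_pow,
      Complex.ofReal_neg, Complex.ofReal_one, map_zpow₀, map_neg, map_one, map_intCast]
    rw [Int.cast_natCast, neg_mul, neg_mul]
    ring
  · obtain ⟨k, rfl⟩ : ∃ k : ℕ, m = -k := ⟨m.natAbs, by omega⟩
    refine ⟨((-1 : ℂ) ^ (-k : ℤ) *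
      (Real.sqrt (((2 * l + 1) * Nat.factorial ((l : ℤ) - (-k : ℤ)).toNat) /
        (4 * π * Nat.factorial ((l : ℤ) + (-k : ℤ)).toNat)) : ℝ)) * ((-1) ^ k *
        ((Nat.factorial (l - k) : ℝ) / (Nat.factorial (l + k) : ℝ) : ℝ) * (-1) ^ k),
        fun v => (starRingEnd ℂ) (WW l k v), ?_, ?_, ?_⟩
    · exact Complex.conjCLE.contDiff.comp (WW_contDiff l k)
    · intro a b γ
      have := WW_mean l k a b γ
      rw [intervalIntegral.integral_of_le two_pi_pos.le] at this ⊢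
      rw [integral_conj, this]
      simp only [map_mul, Complex.conj_ofReal, map_ofNat]
    intro β hβ α
    show _ = _ * (starRingEnd ℂ) (WW l k (Theta β α))
    rw [← sphY_pos l k β α hβ]
    simp only [sphY, assocP, not_le.mpr h, if_false, Int.natAbs_neg, Int.natAbs_natCast, map_mul, map_pow,
      Complex.conj_ofReal,
      ← Complex.exp_conj, Complex.conj_I, Complex.ofReal_mul, Complex.ofReal_pow, Complex.ofReal_neg,
      Complex.ofReal_one, map_zpow₀, map_neg, map_one, map_intCast, map_natCast]
    rw [Int.cast_neg, Int.cast_natCast]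
    simp only [neg_mul, mul_neg, neg_neg]
    ring

/-- The `(l,m)` spherical-harmonic coefficient of the data equals a weighted Abel-type
integral of the `(l,m)` coefficient of the object. -/
theorem sh_expansion_of_toric_radon
    (R rm rM : ℝ) (hR : 0 < R) (hRm : R < rm) (hmM : rm < rM)
    (f : (Fin 3 → ℝ) → ℝ) (hf : ContDiff ℝ (⊤ : ℕ∞) f)
    (hsupp : Function.support f ⊆ shell rm rM)
    (l : ℕ) (m : ℤ) (hm : |m| ≤ (l : ℤ))
    (ω : ℝ) (hω : ω ∈ Set.Ioo (π / 2) π) :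
    (∫ α in (0:ℝ)..(2 * π), ∫ β in (0:ℝ)..π,
        (RT R f α β ω : ℂ) * (starRingEnd ℂ) (sphY l m β α) * (Real.sin β : ℂ))
      = ((2 * π : ℝ) : ℂ) * ∫ γ in (0:ℝ)..(2 * ω - π),
          ((rr R ω γ * (Real.sin γ / Real.sin ω) : ℝ) : ℂ) * coefflm f l m (rr R ω γ) *
            ((legP l (Real.cos γ) : ℝ) : ℂ) := by
  obtain ⟨C, S, hS, hmean, hY⟩ := sphY_conj l m
  have key := core R ω f (hf.of_le (by exact_mod_cast le_top)) S hS l hmean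
  have i1 : ∀ (g : ℝ → ℂ) (α : ℝ), ∫ β in (0:ℝ)..π, g β * (starRingEnd ℂ) (sphY l m β α) *
      (Real.sin β : ℂ) = C * ∫ β in (0:ℝ)..π, g β * S (Theta β α) * (Real.sin β : ℂ) := by
    intro g α
    rw [← intervalIntegral.integral_const_mul]
    apply intervalIntegral.integral_congr
    intro β hβ
    rw [Set.uIcc_of_le pi_pos.le] at hβ
    simp only [hY β hβ α]
    ring
  have i2 : ∀ r, coefflm f l m r = C * ∫ ψ in (0:ℝ)..(2 * π), ∫ β in (0:ℝ)..π,
      (f (r • Theta β ψ) : ℂ) * S (Theta β ψ) * (Real.sin β : ℂ) := by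
    intro r
    rw [coefflm, ← intervalIntegral.integral_const_mul]
    congr 1; funext ψ
    exact i1 (fun β => (f (r • Theta β ψ) : ℂ)) ψ
  have i3 : ∀ α, ∫ β in (0:ℝ)..π, (RT R f α β ω : ℂ) * (starRingEnd ℂ) (sphY l m β α) *
      (Real.sin β : ℂ) = C * ∫ β in (0:ℝ)..π, (RT R f α β ω : ℂ) * S (Theta β α) *
      (Real.sin β : ℂ) := fun α => i1 (fun β => (RT R f α β ω : ℂ)) α
  simp only [i3, i2]
  rw [intervalIntegral.integral_const_mul, key, mul_left_comm, ← intervalIntegral.integral_const_mul]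
  congr 2; funext γ; ring
end
end

section
/- Let l be a natural number and let r₀ > R satisfy P_l(R/r₀) = 0. Set κ1 = −4π P_l'(R/r₀) · √(2 r₀) · √(r₀² − R²) / r₀² and κ2 = 2π P_l'(R/r₀) · √(2 r₀) · √(r₀² − R²) / r₀². Then the one-sided derivative of p ↦ K_l(p, r₀) at p = r₀ taken within [r₀, ∞) equals κ1, and the one-sided derivative of r ↦ K_l(r₀, r) at r = r₀ taken within (R, r₀] equals κ2. Moreover κ1 + κ2 ≠ 0 and 1 + (1/2) · κ1/(κ1 + κ2) = 2 > 0. -/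
noncomputable section
open Real MeasureTheory

def Q1 (R p r : ℝ) : ℝ := 2 * π * r ^ 2 * Real.sqrt (p ^ 2 - R ^ 2) / (R * p * Real.sqrt (p + r))
def Q2 (p r : ℝ) : ℝ := 2 * π * r / p
def Q3 (R p r : ℝ) : ℝ := Real.sqrt (p ^ 2 - R ^ 2) * Real.sqrt (p + r) / p ^ 2
def Q4 (R p r : ℝ) : ℝ := R * r / p ^ 2

/-- The kernel `K_l` in its algebraic form. -/
def Kalg (R : ℝ) (l : ℕ) (p r : ℝ) : ℝ :=
  ∑ σ ∈ ({-1, 1} : Finset ℝ),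
    σ ^ l * (Q1 R p r - σ * Q2 p r * Real.sqrt (p - r)) *
      legP l (Q3 R p r * Real.sqrt (p - r) + σ * Q4 R p r)

open Polynomial in
def legU (l n : ℕ) : ℝ[X] := derivative^[n] ((X ^ 2 - 1) ^ l)

open Polynomial in
lemma legU_succ (l n : ℕ) : derivative (legU l n) = legU l (n+1) := by
  simp [legU, Function.iterate_succ_apply']

open Polynomial in
lemma legU_iter (l n : ℕ) (x : ℝ) :
    iteratedDeriv n (fun y : ℝ => (y ^ 2 - 1) ^ l) x = (legU l n).eval x := by
  have : iteratedDeriv n (fun y : ℝ => (y ^ 2 - 1) ^ l) = fun x => (legU l n).eval x := by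
    induction n with
    | zero => ext x; simp [legU]
    | succ n ih =>
      rw [iteratedDeriv_succ, ih]
      ext x
      rw [Polynomial.deriv, legU_succ]
  rw [this]

open Polynomial in
lemma legU_ode (l n : ℕ) :
    ((X : ℝ[X]) ^ 2 - 1) * legU l (n+2) + C (2 * ((n:ℝ) + 1) - 2 * l) * X * legU l (n+1)
      + C (((n:ℝ) + 1) * (n - 2 * l)) * legU l n = 0 := by
  induction n with
  | zero =>
    have h1 : ((X : ℝ[X]) ^ 2 - 1) * legU l 1 = C (2 * (l:ℝ)) * X * legU l 0 := by
      cases l with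
      | zero => simp [legU]
      | succ l =>
        simp only [legU, Function.iterate_one, Function.iterate_zero, id]
        rw [derivative_pow]
        simp [map_ofNat C 2]
        ring
    have h2 := congrArg derivative h1
    simp only [derivative_mul, legU_succ, derivative_sub, derivative_X_pow, derivative_one, derivative_C, derivative_X] at h2
    simp [map_ofNat C 2] at h2 ⊢
    linear_combination h2
  | succ n ih =>
    have h2 := congrArg derivative ih
    simp only [derivative_add, derivative_mul, legU_succ, derivative_sub, derivative_X_pow, derivative_one, derivative_C, derivative_X] at h2
    simp [map_ofNat C 2] at h2 ⊢
    linear_combination h2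

open Polynomial in
lemma legU_top (l : ℕ) (x : ℝ) : (legU l (2*l)).eval x ≠ 0 := by
  have hm : ((X:ℝ[X]) ^ 2 - 1).Monic := by
    simpa using (monic_X_pow_sub_C (1:ℝ) (n := 2) (by norm_num))
  have hd : ((X:ℝ[X]) ^ 2 - 1).natDegree = 2 := by
    simpa using (natDegree_X_pow_sub_C (n := 2) (r := (1:ℝ)))
  have hm' := hm.pow l
  have hd' : (((X:ℝ[X]) ^ 2 - 1)^l).natDegree = 2 * l := by
    rw [hm.natDegree_pow, hd, mul_comm]
  have h0 : (legU l (2*l)).natDegree = 0 := by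
    have := natDegree_iterate_derivative (((X:ℝ[X]) ^ 2 - 1)^l) (2*l)
    rw [hd'] at this
    unfold legU
    omega
  rw [eq_C_of_natDegree_eq_zero h0, eval_C]
  unfold legU
  rw [coeff_iterate_derivative]
  have h3 : (((X:ℝ[X]) ^ 2 - 1)^l).coeff (0 + 2*l) = 1 := by
    rw [zero_add, ← hd']; exact hm'
  rw [h3, zero_add, Nat.descFactorial_self]
  simp [Nat.factorial_ne_zero]

lemma legU_deriv_ne (l : ℕ) (x : ℝ) (hx : x ^ 2 - 1 ≠ 0) (h : (legU l l).eval x = 0) :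
    (legU l (l+1)).eval x ≠ 0 := by
  intro h1
  have key : ∀ k, (legU l (l+k)).eval x = 0 ∧ (legU l (l+k+1)).eval x = 0 := by
    intro k
    induction k with
    | zero => exact ⟨h, h1⟩
    | succ k ih =>
      refine ⟨ih.2, ?_⟩
      have := congrArg (Polynomial.eval x) (legU_ode l (l+k))
      simp [ih.1, ih.2] at this
      rcases this with h | h
      · exact absurd h hx
      · exact h
  have := (key l).1
  rw [← two_mul] at this
  exact legU_top l x this

open Polynomial in
lemma taylor3 (P : ℝ[X]) : ∃ G : ℝ → ℝ → ℝ, Continuous (Function.uncurry G) ∧ ∀ a b,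
    P.eval (a + b) = P.eval a + (derivative P).eval a * b
      + (derivative (derivative P)).eval a / 2 * b ^ 2 + b ^ 3 * G a b := by
  induction P using Polynomial.induction_on with
  | C c => exact ⟨fun _ _ => 0, by simpa [Function.uncurry_def] using continuous_const, by simp⟩
  | add P Q hP hQ =>
    obtain ⟨G, hG, h⟩ := hP
    obtain ⟨G', hG', h'⟩ := hQ
    refine ⟨fun a b => G a b + G' a b, hG.add hG', ?_⟩
    intro a b
    simp [h a b, h' a b]
    ring
  | monomial n c ih =>
    obtain ⟨G, hG, h⟩ := ih
    have e : C c * X ^ (n+1) = (C c * X ^ n) * X := by ring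
    rw [e]
    generalize C c * X ^ n = S at h ⊢
    refine ⟨fun a b => (a + b) * G a b + (derivative (derivative S)).eval a / 2, ?_, ?_⟩
    · have : Continuous fun x : ℝ × ℝ => G x.1 x.2 := hG
      simp only [Function.uncurry_def]
      fun_prop
    · intro a b
      simp [h a b]
      ring

lemma hasDeriv_mul_zero {f g : ℝ → ℝ} {f' x : ℝ} {s : Set ℝ} (hf : HasDerivWithinAt f f' s x)
    (h0 : f x = 0) (hg : ContinuousWithinAt g s x) :
    HasDerivWithinAt (fun y => g y * f y) (g x * f') s x := by
  rw [hasDerivWithinAt_iff_tendsto_slope] at hf ⊢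
  have hg' := (hg.mono Set.sdiff_subset : ContinuousWithinAt g (s \ {x}) x)
  refine (Filter.Tendsto.mul hg' hf).congr ?_
  intro y
  simp [slope_def_field, h0]
  ring

open Polynomial in
lemma main_aux (P : ℝ[X]) (q1 q2 q3 q4 s d : ℝ → ℝ) (q4' d' x : ℝ) (S : Set ℝ)
    (h1 : ContinuousWithinAt q1 S x) (h2 : ContinuousWithinAt q2 S x)
    (h3 : ContinuousWithinAt q3 S x) (h4 : HasDerivWithinAt q4 q4' S x)
    (hs : ContinuousWithinAt s S x) (hd : HasDerivWithinAt d d' S x) (hxS : x ∈ S)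
    (hsd : ∀ y ∈ S, s y ^ 2 = d y) (hd0 : d x = 0) (hP : P.eval (q4 x) = 0)
    (hode : q1 x * q3 x ^ 2 * (derivative (derivative P)).eval (q4 x)
      - 2 * q2 x * q3 x * (derivative P).eval (q4 x) = 0) :
    HasDerivWithinAt (fun y => (q1 y - q2 y * s y) * P.eval (q4 y + q3 y * s y)
        + (q1 y + q2 y * s y) * P.eval (q4 y - q3 y * s y))
      (2 * q1 x * ((derivative P).eval (q4 x) * q4')) S x := by
  obtain ⟨G, hG, hT⟩ := taylor3 P
  have hs0 : s x = 0 := by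
    have := hsd x hxS
    rw [hd0] at this
    exact pow_eq_zero_iff (two_ne_zero) |>.1 this
  have hc4 := h4.continuousWithinAt
  have hPd : HasDerivWithinAt (fun y => P.eval (q4 y)) ((derivative P).eval (q4 x) * q4') S x :=
    (P.hasDerivAt (q4 x)).comp_hasDerivWithinAt x h4
  have A := hasDeriv_mul_zero hPd hP (h1.const_mul 2 : ContinuousWithinAt (fun y => 2 * q1 y) S x)
  have g1 : ContinuousWithinAt (fun y => G (q4 y) (q3 y * s y)) S x :=
    hG.continuousAt.comp_continuousWithinAt (f := fun y => (q4 y, q3 y * s y))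
      (hc4.prodMk (h3.mul hs))
  have g2 : ContinuousWithinAt (fun y => G (q4 y) (-(q3 y * s y))) S x :=
    hG.continuousAt.comp_continuousWithinAt (f := fun y => (q4 y, -(q3 y * s y)))
      (hc4.prodMk (h3.mul hs).neg)
  have p1 : ContinuousWithinAt (fun y => (derivative P).eval (q4 y)) S x :=
    (derivative P).continuous.continuousAt.comp_continuousWithinAt hc4
  have p2 : ContinuousWithinAt (fun y => (derivative (derivative P)).eval (q4 y)) S x :=
    (derivative (derivative P)).continuous.continuousAt.comp_continuousWithinAt hc4
  have hH : ContinuousWithinAt (fun y => q1 y * q3 y ^ 2 * (derivative (derivative P)).eval (q4 y)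
      - 2 * q2 y * q3 y * (derivative P).eval (q4 y)
      + s y * q3 y ^ 3 * ((q1 y - q2 y * s y) * G (q4 y) (q3 y * s y)
        - (q1 y + q2 y * s y) * G (q4 y) (-(q3 y * s y)))) S x := by
    exact ((((h1.mul (h3.pow 2)).mul p2).sub (((h2.const_mul 2).mul h3).mul p1)).add
      ((hs.mul (h3.pow 3)).mul (((h1.sub (h2.mul hs)).mul g1).sub ((h1.add (h2.mul hs)).mul g2))))
  have B := hasDeriv_mul_zero hd hd0 hH
  have E := A.add B
  refine (E.congr_deriv ?_).congr_of_mem ?_ hxS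
  · simp only [hode, hs0]; ring
  · intro y hy
    simp only [Pi.add_apply]
    rw [sub_eq_add_neg (q4 y), hT, hT, ← hsd y hy]
    ring

/-- The gradient of the kernel at a diagonal zero: one-sided partial derivatives
`κ1, κ2`, and the Schiefeneder–Haltmeier condition `1 + κ1/(2(κ1 + κ2)) = 2 > 0`. -/
theorem kernel_gradient_at_diagonal_zero
    (R : ℝ) (hR : 0 < R) (l : ℕ) (r₀ : ℝ) (hr₀ : R < r₀)
    (hzero : legP l (R / r₀) = 0) (κ1 κ2 : ℝ)
    (hκ1 : κ1 = -4 * π * deriv (legP l) (R / r₀) *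
        (Real.sqrt (2 * r₀) * Real.sqrt (r₀ ^ 2 - R ^ 2) / r₀ ^ 2))
    (hκ2 : κ2 = 2 * π * deriv (legP l) (R / r₀) *
        (Real.sqrt (2 * r₀) * Real.sqrt (r₀ ^ 2 - R ^ 2) / r₀ ^ 2)) :
    derivWithin (fun p => Kalg R l p r₀) (Set.Ici r₀) r₀ = κ1 ∧
    derivWithin (fun r => Kalg R l r₀ r) (Set.Ioc R r₀) r₀ = κ2 ∧
    κ1 + κ2 ≠ 0 ∧
    1 + (1 / 2) * (κ1 / (κ1 + κ2)) = 2 ∧ (0 : ℝ) < 2 := by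
  have hr : 0 < r₀ := hR.trans hr₀
  obtain ⟨c, hc, hcdef⟩ : ∃ c : ℝ, c ≠ 0 ∧ c = 1 / (2 ^ l * Nat.factorial l : ℝ) :=
    ⟨_, by positivity, rfl⟩
  obtain ⟨P, hP⟩ : ∃ P : Polynomial ℝ, P = Polynomial.C c * legU l l := ⟨_, rfl⟩
  have hleg : legP l = fun x => P.eval x := by
    ext x; simp [legP, hP, legU_iter, hcdef]
  have hP1 : Polynomial.derivative P = Polynomial.C c * legU l (l+1) := by
    rw [hP, Polynomial.derivative_C_mul, legU_succ]
  have hP2 : Polynomial.derivative (Polynomial.derivative P) = Polynomial.C c * legU l (l+2) := by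
    rw [hP1, Polynomial.derivative_C_mul, legU_succ]
  have hpar : ∀ x, (-1:ℝ) ^ l * P.eval (-x) = P.eval x := by
    intro x
    have h := iteratedDeriv_comp_neg l (fun y : ℝ => (y ^ 2 - 1) ^ l) x
    simp only [neg_sq, smul_eq_mul] at h
    rw [legU_iter, legU_iter] at h
    simp only [hP, Polynomial.eval_mul, Polynomial.eval_C]
    rw [h]; ring
  have hK : ∀ p r, Kalg R l p r = (Q1 R p r - Q2 p r * √(p - r)) * P.eval (Q4 R p r + Q3 R p r * √(p-r))
      + (Q1 R p r + Q2 p r * √(p - r)) * P.eval (Q4 R p r - Q3 R p r * √(p-r)) := by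
    intro p r
    unfold Kalg
    rw [Finset.sum_pair (by norm_num), hleg, ← hpar (Q4 R p r - Q3 R p r * √(p-r))]
    have e1 : -(Q4 R p r - Q3 R p r * √(p-r)) = Q3 R p r * √(p - r) + -1 * Q4 R p r := by ring
    rw [e1, add_comm (Q4 R p r) _]
    simp only [one_pow, one_mul]
    ring
  have hw0 : 0 < r₀ ^ 2 - R ^ 2 := by nlinarith
  obtain ⟨w, hw⟩ : ∃ w, w = √(r₀ ^ 2 - R ^ 2) := ⟨_, rfl⟩
  obtain ⟨t, ht⟩ : ∃ t, t = √(2 * r₀) := ⟨_, rfl⟩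
  have ht' : √(r₀ + r₀) = t := by rw [ht, two_mul]
  have hwp : 0 < w := by rw [hw]; exact Real.sqrt_pos.2 hw0
  have htp : 0 < t := by rw [ht]; exact Real.sqrt_pos.2 (by positivity)
  have hw2 : w ^ 2 = r₀ ^ 2 - R ^ 2 := by rw [hw]; exact Real.sq_sqrt hw0.le
  have ht2 : t ^ 2 = 2 * r₀ := by rw [ht]; exact Real.sq_sqrt (by positivity)
  have hQ4 : Q4 R r₀ r₀ = R / r₀ := by unfold Q4; field_simp
  have hQ1 : Q1 R r₀ r₀ = 2 * π * r₀ * w / (R * t) := by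
    unfold Q1; rw [ht', ← hw]; field_simp
  have hQ2 : Q2 r₀ r₀ = 2 * π := by unfold Q2; field_simp
  have hQ3 : Q3 R r₀ r₀ = w * t / r₀ ^ 2 := by unfold Q3; rw [ht', ← hw]
  have hz : P.eval (R / r₀) = 0 := by rw [hleg] at hzero; exact hzero
  have hz' : (legU l l).eval (R / r₀) = 0 := by
    simpa [hP, hc] using hz
  have hode0 : w ^ 2 * (Polynomial.derivative (Polynomial.derivative P)).eval (R / r₀)
      = 2 * R * r₀ * (Polynomial.derivative P).eval (R / r₀) := by
    have := congrArg (Polynomial.eval (R / r₀)) (legU_ode l l)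
    simp [hz'] at this
    rw [hP2, hP1, hw2]
    simp only [Polynomial.eval_mul, Polynomial.eval_C]
    field_simp at this
    linear_combination (-c) * this
  have hd1 : deriv (legP l) (R / r₀) = (Polynomial.derivative P).eval (R / r₀) := by
    rw [hleg, Polynomial.deriv]
  have hD : (Polynomial.derivative P).eval (R / r₀) ≠ 0 := by
    rw [hP1]
    simp only [Polynomial.eval_mul, Polynomial.eval_C]
    refine mul_ne_zero hc (legU_deriv_ne l _ ?_ hz')
    have : (R / r₀) ^ 2 < 1 := by
      rw [div_pow, div_lt_one (by positivity)]; linarith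
    linarith
  rw [hd1, ← ht, ← hw] at hκ1 hκ2
  generalize hD0 : (Polynomial.derivative P).eval (R / r₀) = D at *
  have hode : Q1 R r₀ r₀ * Q3 R r₀ r₀ ^ 2 *
      (Polynomial.derivative (Polynomial.derivative P)).eval (Q4 R r₀ r₀)
      - 2 * Q2 r₀ r₀ * Q3 R r₀ r₀ * (Polynomial.derivative P).eval (Q4 R r₀ r₀) = 0 := by
    rw [hQ1, hQ2, hQ3, hQ4, hD0]
    generalize (Polynomial.derivative (Polynomial.derivative P)).eval (R / r₀) = D2 at *
    field_simp
    linear_combination 2 * π * w * t * hode0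
  have hne : r₀ ≠ 0 := hr.ne'
  have hpi := Real.pi_pos
  have htne : √(r₀ + r₀) ≠ 0 := by rw [ht']; exact htp.ne'
  have hR' := hR.ne'
  have hd12 : R * r₀ * √(r₀ + r₀) ≠ 0 := by positivity
  refine ⟨?_, ?_, ?_, ?_, by norm_num⟩
  · simp only [hK]
    have := main_aux P (fun p => Q1 R p r₀) (fun p => Q2 p r₀) (fun p => Q3 R p r₀)
      (fun p => Q4 R p r₀) (fun p => √(p - r₀)) (fun p => p - r₀) (-2 * R / r₀ ^ 2) 1 r₀ (Set.Ici r₀)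
      (by
        refine ContinuousAt.continuousWithinAt ?_
        unfold Q1
        exact ContinuousAt.div (by fun_prop) (by fun_prop) hd12)
      (by
        refine ContinuousAt.continuousWithinAt ?_
        unfold Q2
        exact ContinuousAt.div (by fun_prop) (by fun_prop) hne)
      (by
        refine ContinuousAt.continuousWithinAt ?_
        unfold Q3
        exact ContinuousAt.div (by fun_prop) (by fun_prop) (by positivity))
      (by
        refine HasDerivAt.hasDerivWithinAt ?_
        unfold Q4
        have := (hasDerivAt_const r₀ (R * r₀)).div (hasDerivAt_pow 2 r₀) (by positivity)
        refine this.congr_deriv ?_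
        field_simp
        norm_num
        ring)
      (by fun_prop) ((hasDerivWithinAt_id _ _).sub_const _) Set.self_mem_Ici
      (fun y hy => Real.sq_sqrt (sub_nonneg.2 hy)) (sub_self _) (by simp only [hQ4, hz]) hode
    rw [this.derivWithin (uniqueDiffOn_Ici r₀ _ Set.self_mem_Ici)]
    simp only [hQ1, hQ4, hD0, hκ1]
    field_simp
    linear_combination 4 * ht2
  · simp only [hK]
    have hmem : r₀ ∈ Set.Ioc R r₀ := ⟨hr₀, le_rfl⟩
    have := main_aux P (fun r => Q1 R r₀ r) (fun r => Q2 r₀ r) (fun r => Q3 R r₀ r)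
      (fun r => Q4 R r₀ r) (fun r => √(r₀ - r)) (fun r => r₀ - r) (R / r₀ ^ 2) (-1) r₀ (Set.Ioc R r₀)
      (by
        refine ContinuousAt.continuousWithinAt ?_
        unfold Q1
        exact ContinuousAt.div (by fun_prop) (by fun_prop) hd12)
      (by
        refine ContinuousAt.continuousWithinAt ?_
        unfold Q2
        exact ContinuousAt.div (by fun_prop) (by fun_prop) hne)
      (by
        refine ContinuousAt.continuousWithinAt ?_
        unfold Q3
        exact ContinuousAt.div (by fun_prop) (by fun_prop) (by positivity))
      (by
        refine HasDerivAt.hasDerivWithinAt ?_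
        unfold Q4
        have := ((hasDerivAt_id r₀).const_mul R).div_const (r₀ ^ 2)
        simpa using this)
      (by fun_prop) ((hasDerivWithinAt_id _ _).const_sub _) hmem
      (fun y hy => Real.sq_sqrt (sub_nonneg.2 hy.2)) (sub_self _) (by simp only [hQ4, hz]) hode
    rw [this.derivWithin (uniqueDiffOn_Ioc R r₀ _ hmem)]
    simp only [hQ1, hQ4, hD0, hκ2]
    field_simp
    linear_combination (-1) * ht2
  · have : κ1 + κ2 = -2 * π * D * (t * w / r₀ ^ 2) := by rw [hκ1, hκ2]; ring
    rw [this]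
    positivity
  · have h1 : κ1 + κ2 = -2 * π * D * (t * w / r₀ ^ 2) := by rw [hκ1, hκ2]; ring
    rw [h1, hκ1]
    field_simp
    norm_num
end
end
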